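/- arXiv:1007.0665 — 2 statements merged into one kernel-verified Lean document; each statement's English description precedes it below -/
import Mathlib

section
/- Let a₁, …, a_r ∈ L be finitely many elements with ‖a_i‖ ≤ 1 for all i and ‖a₁ + ⋯ + a_r‖ = 1. Then ‖(∏_{i=1}^{r} E_γ(a_i)) − 1‖ = p^(−1/(p−1)); in particular, the products x_u = ∏_j E_γ(u_j η^{p^j}) attached to units u satisfy that x_u − 1 is a uniformising parameter. -/
/-- The `n`-th coefficient `e n` of Dwork's exponential power series
`E_γ(X) = exp(γ X − γ X^p) = Σ_{n ≥ 0} e_n X^n`, the formal power series obtained by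
substituting the constant-term-zero series `γ X − γ X^p` into
`exp(X) = Σ_{n ≥ 0} X^n / n!`.  Expanding `exp(γ X) · exp(−γ X^p)` gives the explicit
convolution formula `e_n = Σ_{i + p·j = n} (γ^i / i!) · ((−γ)^j / j!)`. -/
noncomputable def dworkCoeff (L : Type*) [Field L] (p : ℕ) (γ : L) (n : ℕ) : L :=
  ∑ j ∈ Finset.range (n / p + 1),
    (γ ^ (n - p * j) / ((n - p * j).factorial : L)) * ((-γ) ^ j / (j.factorial : L))

open PowerSeries

theorem PadicInt.prime_dvd_coeff_expand_sub_pow {p : ℕ} [hp : Fact p.Prime] (g : ℤ_[p]⟦X⟧)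
    (n : ℕ) : (p : ℤ_[p]) ∣ coeff n (expand p hp.out.ne_zero g - g ^ p) := by
  have h : map (PadicInt.toZMod (p := p)) (expand p hp.out.ne_zero g) = map PadicInt.toZMod (g ^ p) := by
    rw [map_expand, map_pow, expand, ← MvPowerSeries.map_frobenius_expand p hp.out.ne_zero,
      ZMod.frobenius_zmod]
    exact (congrFun (congrArg DFunLike.coe (MvPowerSeries.map_id)) _).symm
  rw [← Ideal.mem_span_singleton, ← PadicInt.maximalIdeal_eq_span_p, ← PadicInt.ker_toZMod,
    RingHom.mem_ker, map_sub, map_sub, ← coeff_map, ← coeff_map, h, sub_self]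

/-- **Dwork's integrality lemma**, up to degree `N`: a power series `A` over `ℚ_[p]` with constant
coefficient `1` and `A(X) ^ p ≡ A(X ^ p)` modulo `p ℤ_[p]⟦X⟧ * A(X ^ p)` is integral. -/
theorem Padic.norm_coeff_le_one_of_coeff_pow_eq {p : ℕ} [hp : Fact p.Prime] {A : ℚ_[p]⟦X⟧}
    (hA : constantCoeff A = 1) (U : ℤ_[p]⟦X⟧) {N : ℕ}
    (h : ∀ n < N, coeff n (A ^ p) =
      coeff n ((1 + C (p : ℚ_[p]) * map PadicInt.Coe.ringHom U) * expand p hp.out.ne_zero A)) :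
    ∀ n < N, ‖coeff n A‖ ≤ 1 := by
  intro n
  induction n using Nat.strong_induction_on with
  | _ n ih =>
  intro hn
  rcases Nat.eq_zero_or_pos n with rfl | hpos
  · simp [hA]
  have hp0 : (p : ℚ_[p]) ≠ 0 := by exact_mod_cast hp.out.ne_zero
  have hlift (i : ℕ) : ∃ z : ℤ_[p], PadicInt.Coe.ringHom z = if i < n then coeff i A else 0 := by
    split_ifs with hi
    · exact ⟨⟨_, ih i hi (hi.trans hn)⟩, rfl⟩
    · exact ⟨0, map_zero _⟩
  choose z hz using hlift
  let g : ℤ_[p]⟦X⟧ := .mk z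
  set G : ℚ_[p]⟦X⟧ := map PadicInt.Coe.ringHom g with hG
  have hGlt : ∀ i < n, coeff i G = coeff i A := by
    intro i hi
    rw [hG, coeff_map, coeff_mk, hz, if_pos hi]
  have hGn : coeff n G = 0 := by rw [hG, coeff_map, coeff_mk, hz, if_neg n.lt_irrefl]
  have hG0 : constantCoeff G = 1 := by
    rw [← coeff_zero_eq_constantCoeff_apply, hGlt 0 hpos, coeff_zero_eq_constantCoeff_apply, hA]
  obtain ⟨B, hB⟩ : X ^ n ∣ A - G := by
    rw [X_pow_dvd_iff]
    intro i hi
    rw [map_sub, hGlt i hi, sub_self]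
  have hB0 : constantCoeff B = coeff n A := by
    have := congrArg (coeff n) hB
    rw [map_sub, hGn, sub_zero, coeff_X_pow_mul'] at this
    simpa using this.symm
  have h1 : coeff n (A ^ p) = coeff n (G ^ p) + p * coeff n A := by
    have h2 := geom_sum₂_mul A G p
    rw [hB, mul_left_comm, eq_sub_iff_add_eq] at h2
    rw [← h2, map_add, coeff_X_pow_mul', add_comm]
    simp [hA, hG0, hB0]
  have h3 : coeff n ((1 + C (p : ℚ_[p]) * map PadicInt.Coe.ringHom U) *
        expand p hp.out.ne_zero A) =
      coeff n ((1 + C (p : ℚ_[p]) * map PadicInt.Coe.ringHom U) * expand p hp.out.ne_zero G) := by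
    rw [coeff_mul, coeff_mul]
    refine Finset.sum_congr rfl fun x hx => ?_
    have hx2 : x.2 ≤ n := by
      have := Finset.HasAntidiagonal.mem_antidiagonal.mp hx
      omega
    congr 1
    rw [coeff_expand, coeff_expand]
    split_ifs with hd
    · refine (hGlt _ ?_).symm
      exact lt_of_le_of_lt (Nat.div_le_div_right hx2) (Nat.div_lt_self hpos hp.out.one_lt)
    · rfl
  obtain ⟨w, hw⟩ := PadicInt.prime_dvd_coeff_expand_sub_pow g n
  have h4 : (p : ℚ_[p]) * coeff n A =
      p * ((w + coeff n (U * expand p hp.out.ne_zero g) : ℤ_[p]) : ℚ_[p]) := by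
    have h5 := h n hn
    rw [h1, h3, hG, ← map_expand, ← map_pow, add_mul, one_mul, mul_assoc, ← map_mul, map_add,
      coeff_C_mul, coeff_map, coeff_map, coeff_map] at h5
    have h6 := congrArg (PadicInt.Coe.ringHom (p := p)) hw
    rw [map_sub, map_sub, map_mul, map_natCast] at h6
    rw [PadicInt.coe_add, mul_add]
    change _ = (p : ℚ_[p]) * PadicInt.Coe.ringHom w + (p : ℚ_[p]) * PadicInt.Coe.ringHom _
    linear_combination h5 + h6
  rw [mul_left_cancel₀ hp0 h4]
  exact PadicInt.norm_le_one _

/-- The power series `exp (c X ^ m)`. -/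
noncomputable def PowerSeries.expMonomial {K : Type*} [Field K] [Algebra ℚ K] (c : K)
    {m : ℕ} (hm : m ≠ 0) : K⟦X⟧ :=
  expand m hm (rescale c (exp K))

section

variable {K : Type*} [Field K] [Algebra ℚ K]

theorem PowerSeries.coeff_expMonomial (c : K) {m : ℕ} (hm : m ≠ 0) (n : ℕ) :
    coeff n (expMonomial c hm) = if m ∣ n then c ^ (n / m) / ((n / m).factorial : K) else 0 := by
  simp [expMonomial, coeff_expand, coeff_rescale, coeff_exp, div_eq_mul_inv]

theorem PowerSeries.expMonomial_congr {c d : K} (hcd : c = d) {m m' : ℕ} (hmm' : m = m')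
    {hm : m ≠ 0} {hm' : m' ≠ 0} : expMonomial c hm = expMonomial d hm' := by
  subst hcd hmm'
  rfl

theorem PowerSeries.constantCoeff_expMonomial (c : K) {m : ℕ} (hm : m ≠ 0) :
    constantCoeff (expMonomial c hm) = 1 := by
  rw [← coeff_zero_eq_constantCoeff_apply, coeff_expMonomial]
  simp

theorem PowerSeries.expMonomial_mul_expMonomial (c d : K) {m : ℕ} (hm : m ≠ 0) :
    expMonomial c hm * expMonomial d hm = expMonomial (c + d) hm := by
  rw [expMonomial, expMonomial, ← map_mul, exp_mul_exp_eq_exp_add, expMonomial]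

theorem PowerSeries.expMonomial_zero {m : ℕ} (hm : m ≠ 0) :
    expMonomial (0 : K) hm = 1 := by
  simp [expMonomial]

theorem PowerSeries.expMonomial_pow (c : K) {m : ℕ} (hm : m ≠ 0) (k : ℕ) :
    expMonomial c hm ^ k = expMonomial (k * c) hm := by
  induction k with
  | zero => simp [expMonomial_zero]
  | succ k ih => rw [pow_succ, ih, expMonomial_mul_expMonomial]; congr 1; push_cast; ring

theorem PowerSeries.expand_expMonomial (c : K) {m k : ℕ} (hm : m ≠ 0) (hk : k ≠ 0) :
    expand k hk (expMonomial c hm) = expMonomial c (mul_ne_zero hk hm) := by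
  rw [expMonomial, ← expand_mul, expMonomial]

theorem PowerSeries.rescale_expMonomial (a c : K) {m : ℕ} (hm : m ≠ 0) :
    rescale a (expMonomial c hm) = expMonomial (a ^ m * c) hm := by
  ext n
  rw [coeff_rescale, coeff_expMonomial, coeff_expMonomial]
  split_ifs with h
  · obtain ⟨k, rfl⟩ := h
    rw [Nat.mul_div_cancel_left _ (Nat.pos_of_ne_zero hm), mul_pow, pow_mul, mul_div_assoc]
  · simp

theorem PowerSeries.coeff_mul_expMonomial_of_lt (F : K⟦X⟧) (c : K) {m : ℕ} (hm : m ≠ 0) {n : ℕ}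
    (hn : n < m) : coeff n (F * expMonomial c hm) = coeff n F := by
  rw [coeff_mul, Finset.sum_eq_single (n, 0)]
  · simp [constantCoeff_expMonomial]
  · rintro ⟨i, j⟩ hij hne
    replace hij : i + j = n := Finset.HasAntidiagonal.mem_antidiagonal.mp hij
    rw [coeff_expMonomial, if_neg, mul_zero]
    intro (hd : m ∣ j)
    obtain rfl : j = 0 := Nat.eq_zero_of_dvd_of_lt hd (by omega)
    exact hne (Prod.ext hij rfl)
  · simp

theorem PowerSeries.map_expMonomial {L : Type*} [Field L] [Algebra ℚ L] (f : K →+* L)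
    (c : K) {m : ℕ} (hm : m ≠ 0) :
    map f (expMonomial c hm) = expMonomial (f c) hm := by
  ext n
  rw [coeff_map, coeff_expMonomial, coeff_expMonomial]
  split_ifs <;> simp

end

theorem Padic.norm_factorial (p : ℕ) [hp : Fact p.Prime] (n : ℕ) :
    ‖(n.factorial : ℚ_[p])‖ = ((p : ℝ)⁻¹) ^ padicValNat p n.factorial := by
  rw [Padic.norm_eq_zpow_neg_valuation (by exact_mod_cast n.factorial_ne_zero),
    Padic.valuation_natCast, zpow_neg, zpow_natCast, inv_pow]

theorem Padic.exists_expMonomial_prime_eq (p : ℕ) [hp : Fact p.Prime] :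
    ∃ U : ℤ_[p]⟦X⟧, expMonomial (p : ℚ_[p]) one_ne_zero =
      1 + C (p : ℚ_[p]) * map PadicInt.Coe.ringHom U := by
  have hp0 : (p : ℚ_[p]) ≠ 0 := by exact_mod_cast hp.out.ne_zero
  have hpr : (0 : ℝ) < (p : ℝ)⁻¹ := by have := hp.out.pos; positivity
  have hp1 : (p : ℝ)⁻¹ ≤ 1 := inv_le_one_of_one_le₀ (by exact_mod_cast hp.out.one_le)
  have key (n : ℕ) (hn : n ≠ 0) : ‖(p : ℚ_[p]) ^ (n - 1) / (n.factorial : ℚ_[p])‖ ≤ 1 := by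
    rw [norm_div, norm_pow, Padic.norm_p, Padic.norm_factorial,
      div_le_one (by positivity)]
    refine pow_le_pow_of_le_one hpr.le hp1 ?_
    have := padicValNat_factorial_lt_of_ne_zero p hn
    omega
  refine ⟨.mk fun n => if hn : n = 0 then 0 else ⟨_, key n hn⟩, ?_⟩
  ext n
  rw [coeff_expMonomial, map_add, coeff_C_mul, coeff_map, coeff_mk, coeff_one]
  rcases n with _ | n
  · simp
  · simp only [Nat.succ_ne_zero, if_false, one_dvd, if_true, Nat.div_one, zero_add]
    change _ = (p : ℚ_[p]) * ((p : ℚ_[p]) ^ n / _)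
    rw [pow_succ]; ring

/-- The product of the first `K` factors `exp (X ^ p ^ k / p ^ k)` of the Artin–Hasse exponential. -/
noncomputable def PowerSeries.artinHassePartial (F : Type*) [Field F] [Algebra ℚ F]
    (p : ℕ) [hp : Fact p.Prime] (K : ℕ) : F⟦X⟧ :=
  ∏ k ∈ Finset.range K, expMonomial ((p : F) ^ k)⁻¹ (pow_ne_zero k hp.out.ne_zero)

theorem PowerSeries.artinHassePartial_pow_mul_expMonomial (F : Type*) [Field F] [Algebra ℚ F] (p : ℕ)
    [hp : Fact p.Prime] (K : ℕ) :
    artinHassePartial F p K ^ p *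
        expMonomial (p * ((p : F) ^ K)⁻¹) (pow_ne_zero K hp.out.ne_zero) =
      expMonomial (p : F) one_ne_zero * expand p hp.out.ne_zero (artinHassePartial F p K) := by
  have : CharZero F := algebraRat.charZero F
  have hp0 : (p : F) ≠ 0 := by exact_mod_cast hp.out.ne_zero
  simp only [artinHassePartial, map_prod, expand_expMonomial, ← Finset.prod_pow, expMonomial_pow]
  rw [← Finset.prod_range_succ
    (fun k => expMonomial ((p : F) * ((p : F) ^ k)⁻¹) (pow_ne_zero k hp.out.ne_zero)),
    Finset.prod_range_succ', mul_comm]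
  congr 1
  · simp
  · refine Finset.prod_congr rfl fun k _ => expMonomial_congr ?_ (pow_succ' p k)
    rw [pow_succ]
    field_simp

theorem Padic.norm_coeff_artinHassePartial_le_one (p : ℕ) [hp : Fact p.Prime] (K : ℕ) :
    ∀ n < p ^ K, ‖coeff n (artinHassePartial ℚ_[p] p K)‖ ≤ 1 := by
  obtain ⟨U, hU⟩ := Padic.exists_expMonomial_prime_eq p
  refine Padic.norm_coeff_le_one_of_coeff_pow_eq ?_ U fun n hn => ?_
  · simp [artinHassePartial, map_prod, constantCoeff_expMonomial]
  · rw [← hU, ← artinHassePartial_pow_mul_expMonomial, coeff_mul_expMonomial_of_lt _ _ _ hn]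

theorem dworkCoeff_eq_coeff (L : Type*) [Field L] [Algebra ℚ L] {p : ℕ} (hp : p ≠ 0) (γ : L) (n : ℕ) :
    dworkCoeff L p γ n = coeff n (expMonomial γ one_ne_zero * expMonomial (-γ) hp) := by
  rw [mul_comm, coeff_mul, Finset.Nat.sum_antidiagonal_eq_sum_range_succ_mk, dworkCoeff]
  simp only [coeff_expMonomial, one_dvd, if_true, Nat.div_one, ite_mul, zero_mul]
  rw [← Finset.sum_filter]
  refine Finset.sum_nbij' (fun j => p * j) (fun i => i / p) ?_ ?_ ?_ ?_ ?_
  · intro j hj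
    rw [Finset.mem_range, Nat.lt_succ_iff, Nat.le_div_iff_mul_le (Nat.pos_of_ne_zero hp)] at hj
    simp only [Finset.mem_filter, Finset.mem_range, dvd_mul_right, and_true]
    rw [mul_comm]; omega
  · intro i hi
    simp only [Finset.mem_filter, Finset.mem_range] at hi
    exact Finset.mem_range.mpr (Nat.lt_succ_of_le (Nat.div_le_div_right (Nat.le_of_lt_succ hi.1)))
  · intro j _
    exact Nat.mul_div_cancel_left _ (Nat.pos_of_ne_zero hp)
  · intro i hi
    exact Nat.mul_div_cancel' (Finset.mem_filter.mp hi).2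
  · intro j _
    rw [Nat.mul_div_cancel_left _ (Nat.pos_of_ne_zero hp), mul_comm]

theorem PowerSeries.expMonomial_mul_expMonomial_eq_artinHassePartial_mul {L : Type*} [Field L] [Algebra ℚ L]
    {p : ℕ} [hp : Fact p.Prime] {γ : L} (hγ : γ ^ (p - 1) = -(p : L)) {K : ℕ} (hK : 2 ≤ K) :
    expMonomial γ one_ne_zero * expMonomial (-γ) hp.out.ne_zero =
      rescale γ (artinHassePartial L p K) *
        ∏ k ∈ Finset.Ico 2 K,
          expMonomial (-(γ ^ p ^ k * ((p : L) ^ k)⁻¹)) (pow_ne_zero k hp.out.ne_zero) := by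
  have : CharZero L := algebraRat.charZero L
  have hp0 : (p : L) ≠ 0 := by exact_mod_cast hp.out.ne_zero
  simp only [artinHassePartial, map_prod, rescale_expMonomial]
  rw [← Finset.prod_range_mul_prod_Ico _ hK, mul_assoc, ← Finset.prod_mul_distrib]
  simp only [expMonomial_mul_expMonomial, add_neg_cancel, expMonomial_zero, Finset.prod_const_one, mul_one,
    Finset.prod_range_succ, Finset.prod_range_zero, one_mul]
  congr 1
  · exact expMonomial_congr (by simp) (by simp)
  · refine expMonomial_congr ?_ (by simp)
    have : γ ^ p = γ * γ ^ (p - 1) := by rw [← pow_succ', Nat.sub_add_cancel hp.out.one_le]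
    rw [pow_one, pow_one, this, hγ]
    field_simp

theorem PowerSeries.norm_coeff_mul_le {L : Type*} [NormedField L] [IsUltrametricDist L]
    {g σ : ℝ} (hg : 0 ≤ g)
    (hgσ : g ≤ σ) {F G : L⟦X⟧} {N : ℕ} (hF0 : constantCoeff F = 1) (hG0 : constantCoeff G = 1)
    (hF : ∀ n < N, ‖coeff (n + 1) F‖ ≤ g * σ ^ n) (hG : ∀ n < N, ‖coeff (n + 1) G‖ ≤ g * σ ^ n) :
    ∀ n < N, ‖coeff (n + 1) (F * G)‖ ≤ g * σ ^ n := by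
  intro n hn
  have hσ : 0 ≤ σ := hg.trans hgσ
  rw [coeff_mul]
  refine IsUltrametricDist.norm_sum_le_of_forall_le_of_nonneg (by positivity) ?_
  rintro ⟨i, j⟩ hij
  replace hij : i + j = n + 1 := Finset.HasAntidiagonal.mem_antidiagonal.mp hij
  rcases i with _ | i
  · obtain rfl : j = n + 1 := by omega
    simpa [hF0] using hG n hn
  rcases j with _ | j
  · obtain rfl : i = n := by omega
    simpa [hG0] using hF i hn
  · obtain rfl : n = i + j + 1 := by omega
    calc ‖coeff (i + 1) F * coeff (j + 1) G‖ = ‖coeff (i + 1) F‖ * ‖coeff (j + 1) G‖ := norm_mul _ _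
      _ ≤ (g * σ ^ i) * (g * σ ^ j) :=
        mul_le_mul (hF i (by omega)) (hG j (by omega)) (norm_nonneg _) (by positivity)
      _ ≤ (g * σ ^ i) * (σ * σ ^ j) := by gcongr
      _ = g * σ ^ (i + j + 1) := by ring

theorem PowerSeries.norm_coeff_prod_le {L ι : Type*} [NormedField L] [IsUltrametricDist L]
    {g σ : ℝ} (hg : 0 ≤ g)
    (hgσ : g ≤ σ) {F : ι → L⟦X⟧} {N : ℕ} (s : Finset ι) (hF0 : ∀ i ∈ s, constantCoeff (F i) = 1)
    (hF : ∀ i ∈ s, ∀ n < N, ‖coeff (n + 1) (F i)‖ ≤ g * σ ^ n) :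
    ∀ n < N, ‖coeff (n + 1) (∏ i ∈ s, F i)‖ ≤ g * σ ^ n := by
  classical
  have hσ : 0 ≤ σ := hg.trans hgσ
  induction s using Finset.induction_on with
  | empty =>
    intro n _
    rw [Finset.prod_empty, coeff_one, if_neg n.succ_ne_zero, norm_zero]
    positivity
  | insert i s his ih =>
    rw [Finset.prod_insert his]
    refine norm_coeff_mul_le hg hgσ (hF0 i (by simp)) ?_ (hF i (by simp))
      (ih (fun j hj => hF0 j (by simp [hj])) fun j hj => hF j (by simp [hj]))
    rw [map_prod]
    exact Finset.prod_eq_one fun j hj => hF0 j (by simp [hj])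

theorem Nat.pow_sub_two_add_le {p : ℕ} (hp : 2 ≤ p) {k : ℕ} (hk : 2 ≤ k) :
    p ^ (k - 2) + k * (p - 1) + 1 ≤ p ^ k := by
  obtain ⟨q, rfl⟩ := Nat.exists_eq_add_of_le hp
  induction k, hk using Nat.le_induction with
  | base =>
    simp only [Nat.sub_self, pow_zero, show 2 + q - 1 = q + 1 by omega]
    nlinarith
  | succ k hk ih =>
    obtain ⟨l, rfl⟩ := Nat.exists_eq_add_of_le hk
    simp only [show 2 + q - 1 = q + 1 by omega, show 2 + l - 2 = l by omega,
      show 2 + l + 1 - 2 = l + 1 by omega] at ih ⊢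
    rw [pow_succ _ (2 + l), pow_succ _ l]
    nlinarith [Nat.mul_le_mul_right (2 + q) ih, Nat.zero_le (l * q), Nat.zero_le (l * q * q),
      Nat.zero_le (q * q)]

section

variable {p : ℕ} [hp : Fact p.Prime] {L : Type*} [NormedField L] [Algebra ℚ_[p] L]
  (hnorm : ∀ q : ℚ_[p], ‖algebraMap ℚ_[p] L q‖ = ‖q‖) {γ : L} (hγ : γ ^ (p - 1) = -(p : L))
include hnorm

theorem isUltrametricDist_of_norm_algebraMap_padic : IsUltrametricDist L :=
  IsUltrametricDist.isUltrametricDist_of_forall_norm_natCast_le_one fun n => by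
    rw [← map_natCast (algebraMap ℚ_[p] L), hnorm]
    exact IsUltrametricDist.norm_natCast_le_one ℚ_[p] n

include hγ

theorem norm_pow_prime_sub_one : ‖γ‖ ^ (p - 1) = (p : ℝ)⁻¹ := by
  rw [← norm_pow, hγ, norm_neg, ← map_natCast (algebraMap ℚ_[p] L), hnorm, Padic.norm_p]

theorem norm_pos_and_lt_one : 0 < ‖γ‖ ∧ ‖γ‖ < 1 := by
  have h := norm_pow_prime_sub_one hnorm hγ
  have h1 : p - 1 ≠ 0 := Nat.sub_ne_zero_of_lt hp.out.one_lt
  have hpos : (0 : ℝ) < (p : ℝ)⁻¹ := inv_pos.mpr (by exact_mod_cast hp.out.pos)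
  constructor
  · refine (norm_nonneg γ).lt_of_ne' fun h0 => ?_
    rw [h0, zero_pow h1] at h
    exact hpos.ne h
  · rw [← pow_lt_one_iff_of_nonneg (norm_nonneg γ) h1, h]
    exact inv_lt_one_of_one_lt₀ (by exact_mod_cast hp.out.one_lt)

theorem norm_pow_pred_le_norm_factorial {j : ℕ} (hj : j ≠ 0) :
    ‖γ‖ ^ (j - 1) ≤ ‖(j.factorial : L)‖ := by
  rw [← map_natCast (algebraMap ℚ_[p] L), hnorm, Padic.norm_factorial, ← norm_pow_prime_sub_one hnorm hγ,
    ← pow_mul]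
  have := sub_one_mul_padicValNat_factorial_lt_of_ne_zero p hj
  exact pow_le_pow_of_le_one (norm_nonneg _) (norm_pos_and_lt_one hnorm hγ).2.le (by omega)

theorem norm_coeff_expMonomial_le [Algebra ℚ L] {σ : ℝ} (hσ0 : 0 < σ) (hσ1 : σ < 1)
    (hσ : σ ^ p ^ 2 = ‖γ‖)
    {k : ℕ} (hk : 2 ≤ k) (n : ℕ) :
    ‖coeff (n + 1) (expMonomial (-(γ ^ p ^ k * ((p : L) ^ k)⁻¹)) (pow_ne_zero k hp.out.ne_zero))‖
      ≤ ‖γ‖ * σ ^ n := by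
  obtain ⟨hγ0, hγ1⟩ := norm_pos_and_lt_one hnorm hγ
  rw [coeff_expMonomial]
  split_ifs with hd
  swap
  · rw [norm_zero]; positivity
  obtain ⟨j, hj⟩ := hd
  rw [hj, Nat.mul_div_cancel_left _ (pow_pos hp.out.pos k)]
  have hj0 : j ≠ 0 := by rintro rfl; simp at hj
  have hp' : ‖(p : L)‖ = ‖γ‖ ^ (p - 1) := by rw [← norm_pow, hγ, norm_neg]
  have h1 : ‖-(γ ^ p ^ k * ((p : L) ^ k)⁻¹)‖ ≤ ‖γ‖ * σ ^ p ^ k := by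
    rw [norm_neg, norm_mul, norm_inv, norm_pow, norm_pow, hp', ← pow_mul, ← div_eq_mul_inv,
      div_le_iff₀ (by positivity)]
    have : σ ^ p ^ k = ‖γ‖ ^ p ^ (k - 2) := by
      rw [← hσ, ← pow_mul, ← pow_add, Nat.add_sub_cancel' hk]
    rw [this, ← pow_succ', ← pow_add]
    refine pow_le_pow_of_le_one hγ0.le hγ1.le ?_
    have := Nat.pow_sub_two_add_le hp.out.two_le hk
    rw [mul_comm (p - 1)]
    omega
  have h2 := norm_pow_pred_le_norm_factorial hnorm hγ hj0
  rw [norm_div, norm_pow, div_le_iff₀ ((pow_pos hγ0 _).trans_le h2)]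
  calc _ ≤ (‖γ‖ * σ ^ p ^ k) ^ j := by gcongr
    _ = ‖γ‖ * σ ^ (n + 1) * ‖γ‖ ^ (j - 1) := by
      rw [hj, mul_pow, ← pow_mul]
      obtain ⟨i, rfl⟩ := Nat.exists_eq_succ_of_ne_zero hj0
      simp only [Nat.succ_eq_add_one, Nat.add_sub_cancel]
      ring
    _ ≤ ‖γ‖ * σ ^ n * ‖(j.factorial : L)‖ := by
      gcongr ?_ * ?_ * ?_
      exact pow_le_pow_of_le_one hσ0.le hσ1.le n.le_succ

theorem norm_dworkCoeff_succ_le {σ : ℝ} (hσ0 : 0 < σ) (hσ1 : σ < 1)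
    (hσ : σ ^ p ^ 2 = ‖γ‖) (n : ℕ) :
    ‖dworkCoeff L p γ (n + 1)‖ ≤ ‖γ‖ * σ ^ n := by
  have : CharZero L := charZero_of_injective_algebraMap (algebraMap ℚ_[p] L).injective
  have : IsUltrametricDist L := isUltrametricDist_of_norm_algebraMap_padic hnorm
  obtain ⟨hγ0, hγ1⟩ := norm_pos_and_lt_one hnorm hγ
  have hγσ : ‖γ‖ ≤ σ := by
    rw [← hσ]
    exact pow_le_of_le_one hσ0.le hσ1.le (pow_ne_zero 2 hp.out.ne_zero)
  rw [dworkCoeff_eq_coeff L hp.out.ne_zero,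
    expMonomial_mul_expMonomial_eq_artinHassePartial_mul hγ (Nat.le_add_left 2 n)]
  refine norm_coeff_mul_le (N := n + 1) hγ0.le hγσ ?_ ?_ ?_ ?_ n n.lt_succ_self
  · simp [artinHassePartial, map_prod, rescale_expMonomial, constantCoeff_expMonomial]
  · simp [map_prod, constantCoeff_expMonomial]
  · intro i hi
    have hmap : artinHassePartial L p (n + 2) =
        map (algebraMap ℚ_[p] L) (artinHassePartial ℚ_[p] p (n + 2)) := by
      simp [artinHassePartial, map_prod, map_expMonomial]
    have hlt : i + 1 < p ^ (n + 2) := (by omega : i + 1 < n + 2).trans (Nat.lt_pow_self hp.out.one_lt)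
    rw [coeff_rescale, hmap, coeff_map, norm_mul, hnorm, norm_pow, pow_succ']
    calc ‖γ‖ * ‖γ‖ ^ i * _ ≤ ‖γ‖ * σ ^ i * 1 := by
          gcongr
          exact Padic.norm_coeff_artinHassePartial_le_one p _ _ hlt
      _ = _ := mul_one _
  · refine norm_coeff_prod_le hγ0.le hγσ _ ?_ ?_
    · simp [constantCoeff_expMonomial]
    · intro k hk i _
      exact norm_coeff_expMonomial_le hnorm hγ hσ0 hσ1 hσ (Finset.mem_Ico.mp hk).1 i

end

theorem dworkCoeff_zero {L : Type*} [Field L] (p : ℕ) (γ : L) : dworkCoeff L p γ 0 = 1 := by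
  simp [dworkCoeff]

theorem dworkCoeff_one {L : Type*} [Field L] {p : ℕ} (hp : 1 < p) (γ : L) : dworkCoeff L p γ 1 = γ := by
  simp [dworkCoeff, Nat.div_eq_of_lt hp]

theorem norm_prod_sub_one_sub_le {L ι : Type*} [NormedField L] [IsUltrametricDist L] {γ : L} {δ : ℝ}
    (hδ : δ ≤ ‖γ‖) (hγδ : ‖γ‖ * ‖γ‖ ≤ δ) {a F : ι → L} (s : Finset ι) (ha : ∀ i ∈ s, ‖a i‖ ≤ 1)
    (hF : ∀ i ∈ s, ‖F i - 1 - γ * a i‖ ≤ δ) : ‖∏ i ∈ s, F i - 1 - γ * ∑ i ∈ s, a i‖ ≤ δ := by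
  classical
  have hδ0 : 0 ≤ δ := (mul_self_nonneg _).trans hγδ
  induction s using Finset.induction_on with
  | empty => simpa using hδ0
  | insert i s his ih =>
    have ha' : ∀ j ∈ s, ‖a j‖ ≤ 1 := fun j hj => ha j (by simp [hj])
    have hi := hF i (by simp)
    have hs := ih ha' fun j hj => hF j (by simp [hj])
    have hmul {x : L} (hx : ‖x‖ ≤ 1) : ‖γ * x‖ ≤ ‖γ‖ := by
      rw [norm_mul]
      exact mul_le_of_le_one_right (norm_nonneg _) hx
    have hi' : ‖F i - 1‖ ≤ ‖γ‖ := by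
      rw [← sub_add_cancel (F i - 1) (γ * a i)]
      exact (IsUltrametricDist.norm_add_le_max _ _).trans (max_le (hi.trans hδ) (hmul (ha i (by simp))))
    have hs' : ‖∏ j ∈ s, F j - 1‖ ≤ ‖γ‖ := by
      rw [← sub_add_cancel (∏ j ∈ s, F j - 1) (γ * ∑ j ∈ s, a j)]
      exact (IsUltrametricDist.norm_add_le_max _ _).trans (max_le (hs.trans hδ)
        (hmul (IsUltrametricDist.norm_sum_le_of_forall_le_of_nonneg zero_le_one ha')))
    rw [Finset.prod_insert his, Finset.sum_insert his,
      show F i * ∏ j ∈ s, F j - 1 - γ * (a i + ∑ j ∈ s, a j) =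
        (F i - 1) * (∏ j ∈ s, F j - 1) +
          ((F i - 1 - γ * a i) + (∏ j ∈ s, F j - 1 - γ * ∑ j ∈ s, a j)) by ring]
    refine (IsUltrametricDist.norm_add_le_max _ _).trans (max_le ?_
      ((IsUltrametricDist.norm_add_le_max _ _).trans (max_le hi hs)))
    rw [norm_mul]
    exact (mul_le_mul hi' hs' (norm_nonneg _) (norm_nonneg _)).trans hγδ

theorem norm_tsum_mul_pow_sub_le {L : Type*} [NormedField L] [CompleteSpace L] [IsUltrametricDist L]
    {e : ℕ → L} {g σ : ℝ} (hg : 0 ≤ g) (hσ0 : 0 ≤ σ) (hσ1 : σ < 1)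
    (he : ∀ n, ‖e (n + 1)‖ ≤ g * σ ^ n)
    {x : L} (hx : ‖x‖ ≤ 1) : ‖∑' n, e n * x ^ n - e 0 - e 1 * x‖ ≤ g * σ := by
  have hle (n : ℕ) : ‖e (n + 1) * x ^ (n + 1)‖ ≤ g * σ ^ n := by
    rw [norm_mul, norm_pow]
    exact (mul_le_of_le_one_right (norm_nonneg _) (pow_le_one₀ (norm_nonneg _) hx)).trans (he n)
  have hsum : Summable fun n => e n * x ^ n :=
    (summable_nat_add_iff 1).mp
      (.of_norm_bounded ((summable_geometric_of_lt_one hσ0 hσ1).mul_left g) hle)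
  rw [← hsum.sum_add_tsum_nat_add 2, Finset.sum_range_succ, Finset.sum_range_one, pow_zero, mul_one, pow_one,
    show ∀ u v w : L, u + v + w - u - v = w by intros; ring]
  refine IsUltrametricDist.norm_tsum_le_of_forall_le_of_nonneg (by positivity) fun n => (hle (n + 1)).trans ?_
  gcongr
  exact pow_le_of_le_one hσ0 hσ1.le n.succ_ne_zero


/-- If `a₁, …, a_r ∈ L` satisfy `‖a_i‖ ≤ 1` for all `i` and `‖a₁ + ⋯ + a_r‖ = 1`, then
`‖(∏ i, E_γ(a_i)) − 1‖ = p^(−1/(p−1))`; in particular the products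
`x_u = ∏_j E_γ(u_j η^{p^j})` attached to units `u` are such that `x_u − 1` is a
uniformising parameter. -/
theorem dworkSeries_prod_sub_one_norm
    (p : ℕ) [Fact p.Prime] (L : Type*) [NormedField L] [CompleteSpace L]
    [Algebra ℚ_[p] L] (hnorm : ∀ q : ℚ_[p], ‖algebraMap ℚ_[p] L q‖ = ‖q‖)
    (γ : L) (hγ : γ ^ (p - 1) = -(p : L))
    (r : ℕ) (a : Fin r → L) (ha : ∀ i, ‖a i‖ ≤ 1) (hsum : ‖∑ i, a i‖ = 1) :
    ‖(∏ i, ∑' n : ℕ, dworkCoeff L p γ n * a i ^ n) - 1‖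
      = (p : ℝ) ^ (-(1 : ℝ) / ((p : ℝ) - 1)) := by
  have hp : p.Prime := Fact.out
  have : IsUltrametricDist L := isUltrametricDist_of_norm_algebraMap_padic hnorm
  obtain ⟨hγ0, hγ1⟩ := norm_pos_and_lt_one hnorm hγ
  obtain ⟨σ, hσ0, hσ1, hσ⟩ : ∃ σ : ℝ, 0 < σ ∧ σ < 1 ∧ σ ^ p ^ 2 = ‖γ‖ := by
    have hp2 : p ^ 2 ≠ 0 := pow_ne_zero 2 hp.ne_zero
    have h := Real.rpow_inv_natCast_pow hγ0.le hp2
    refine ⟨‖γ‖ ^ ((p ^ 2 : ℕ) : ℝ)⁻¹, Real.rpow_pos_of_pos hγ0 _,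
      Real.rpow_lt_one hγ0.le hγ1 (inv_pos.mpr (by exact_mod_cast Nat.pos_of_ne_zero hp2)), h⟩
  have hγσ : ‖γ‖ ≤ σ := by
    rw [← hσ]
    exact pow_le_of_le_one hσ0.le hσ1.le (pow_ne_zero 2 hp.ne_zero)
  have hlt : ‖γ‖ * σ < ‖γ‖ := mul_lt_of_lt_one_right hγ0 hσ1
  have hprod := norm_prod_sub_one_sub_le hlt.le (mul_le_mul_of_nonneg_left hγσ hγ0.le)
    (F := fun i => ∑' n : ℕ, dworkCoeff L p γ n * a i ^ n) Finset.univ (fun i _ => ha i) fun i _ => by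
      simpa only [dworkCoeff_zero, dworkCoeff_one hp.one_lt] using
        norm_tsum_mul_pow_sub_le hγ0.le hσ0.le hσ1 (norm_dworkCoeff_succ_le hnorm hγ hσ0 hσ1 hσ) (ha i)
  have hmain : ‖γ * ∑ i, a i‖ = ‖γ‖ := by rw [norm_mul, hsum, mul_one]
  have hval : ‖γ‖ = (p : ℝ) ^ (-(1 : ℝ) / ((p : ℝ) - 1)) := by
    have h1 : p - 1 ≠ 0 := Nat.sub_ne_zero_of_lt hp.one_lt
    rw [← Real.pow_rpow_inv_natCast hγ0.le h1, norm_pow_prime_sub_one hnorm hγ, Nat.cast_pred hp.pos,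
      ← Real.rpow_neg_one, ← Real.rpow_mul (Nat.cast_nonneg p), div_eq_mul_inv]
  rw [← hval, ← hmain]
  rw [← norm_neg (γ * _)]
  refine IsUltrametricDist.norm_eq_of_add_norm_lt_max (lt_max_of_lt_right ?_)
  rw [← sub_eq_add_neg, norm_neg, hmain]
  exact hprod.trans_lt hlt
end

section
/- (Norm of Dwork values along a Frobenius orbit.) Let d ≥ 1 and let c ∈ L satisfy ‖c‖ ≤ 1 and c^{p^d} = c (a Teichmüller-type element), and let m be a natural number with ‖(Σ_{n=0}^{d−1} c^{p^n}) − m‖ < 1 (i.e. the 'trace' Σ_{n<d} c^{p^n} is congruent to m modulo the maximal ideal). Then ∏_{n=0}^{d−1} E_γ(c^{p^n}) = E_γ(1)^m. (With c the Teichmüller lift of a normal basis generator η of the residue field of an unramified extension K/ℚ_p of degree d, this gives N_{K(γ)/ℚ_p(ζ)}(x) = ζ^{Tr(ε)} for ζ = E_γ(1).) -/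
/-- The integers `N n` with `exp (Y + Y ^ p / p) = ∑ N n * Y ^ n / n!`; they count the
permutations of `n` letters whose `p`-th power is trivial. -/
def dworkNumerator (p : ℕ) : ℕ → ℕ
  | 0 => 1
  | n + 1 => dworkNumerator p n + n.descFactorial (p - 1) * dworkNumerator p (n - (p - 1))

theorem dworkNumerator_succ (p n : ℕ) : dworkNumerator p (n + 1) =
    dworkNumerator p n + n.descFactorial (p - 1) * dworkNumerator p (n - (p - 1)) := by
  rw [dworkNumerator]

theorem prime_dvd_one_add_descFactorial (p : ℕ) [hp : Fact p.Prime] (q : ℕ) :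
    p ∣ 1 + (p * q + (p - 1)).descFactorial (p - 1) := by
  rw [← CharP.cast_eq_zero_iff (ZMod p) p]
  have h : ((p * q + (p - 1)).descFactorial (p - 1) : ZMod p) = ((p - 1).factorial : ZMod p) := by
    rw [← Nat.descFactorial_self, Nat.descFactorial_eq_prod_range,
      Nat.descFactorial_eq_prod_range]
    push_cast
    refine Finset.prod_congr rfl fun i hi => ?_
    rw [Nat.add_sub_assoc (Finset.mem_range.1 hi).le]
    simp
  push_cast
  rw [h, ZMod.wilsons_lemma]
  simp

theorem pow_succ_dvd_dworkNumerator_of_le {p : ℕ} [hp : Fact p.Prime] {k q : ℕ}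
    (h : ∀ n, p * q ≤ n + p → p ^ k ∣ dworkNumerator p n) :
    ∀ n, p * (q + 1) ≤ n → p ^ (k + 1) ∣ dworkNumerator p n := by
  have hp2 := hp.out.two_le
  have key : ∀ Q, q ≤ Q → ∀ r, r < p →
      dworkNumerator p (p * Q + r) ≡ dworkNumerator p (p * Q) [MOD p ^ (k + 1)] := by
    intro Q hQ r
    have hle : p * q ≤ p * Q := Nat.mul_le_mul_left p hQ
    induction r with
    | zero => intro _; rfl
    | succ r ih =>
      intro hr
      have h1 : p ∣ (p * Q + r).descFactorial (p - 1) := by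
        rw [Nat.descFactorial_eq_prod_range]
        refine Dvd.dvd.trans ?_ (Finset.dvd_prod_of_mem _ (Finset.mem_range.2
          (show r < p - 1 by omega)))
        simp
      have h2 := mul_dvd_mul h1 (h (p * Q + r - (p - 1)) (by omega))
      rw [← pow_succ'] at h2
      rw [← add_assoc, dworkNumerator_succ]
      simpa using (ih (by omega)).add ((Nat.modEq_zero_iff_dvd).2 h2)
  have key2 : ∀ Q, q ≤ Q → p ^ (k + 1) ∣ dworkNumerator p (p * (Q + 1)) := by
    intro Q hQ
    have hle : p * q ≤ p * Q := Nat.mul_le_mul_left p hQ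
    have e : p * (Q + 1) = p * Q + (p - 1) + 1 := by rw [mul_add]; omega
    rw [← Nat.modEq_zero_iff_dvd, e, dworkNumerator_succ, Nat.add_sub_cancel]
    refine ((key Q hQ (p - 1) (by omega)).add_right _).trans ?_
    rw [Nat.modEq_zero_iff_dvd, ← one_add_mul, pow_succ']
    exact mul_dvd_mul (prime_dvd_one_add_descFactorial p Q) (h _ (by omega))
  intro n hn
  have hq : q + 1 ≤ n / p := by
    rw [Nat.le_div_iff_mul_le (by omega), mul_comm]; exact hn
  obtain ⟨Q, hQ⟩ := Nat.exists_eq_add_of_le' (show 1 ≤ n / p by omega)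
  rw [← Nat.div_add_mod n p, ← Nat.modEq_zero_iff_dvd]
  refine (key (n / p) (by omega) _ (Nat.mod_lt _ (by omega))).trans ?_
  rw [Nat.modEq_zero_iff_dvd, hQ]
  exact key2 Q (by omega)

theorem pow_succ_dvd_dworkNumerator {p : ℕ} [hp : Fact p.Prime] (k : ℕ) :
    ∀ n, p * (2 * k + 1) ≤ n → p ^ (k + 1) ∣ dworkNumerator p n := by
  induction k with
  | zero => exact pow_succ_dvd_dworkNumerator_of_le (q := 0) (by simp)
  | succ k ih =>
    refine pow_succ_dvd_dworkNumerator_of_le (q := 2 * k + 2) fun n hn => ih n ?_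
    rw [show 2 * k + 2 = (2 * k + 1) + 1 by ring, mul_add] at hn
    omega

open PowerSeries in
theorem mk_dworkCoeff {L : Type*} [Field L] [CharZero L] {p : ℕ} (hp : p ≠ 0) (γ : L) :
    PowerSeries.mk (dworkCoeff L p γ) =
      rescale γ (exp L) * expand p hp (rescale (-γ) (exp L)) := by
  ext n
  have hp0 : 0 < p := Nat.pos_of_ne_zero hp
  rw [coeff_mk, coeff_mul, Finset.Nat.sum_antidiagonal_eq_sum_range_succ
    (fun i j => coeff i (rescale γ (exp L)) * coeff j (expand p hp (rescale (-γ) (exp L)))),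
    ← Finset.sum_range_reflect]
  simp only [coeff_expand, coeff_rescale, coeff_exp]
  have h : ∀ j ∈ Finset.range n.succ, n - (n.succ - 1 - j) = j := by
    intro j hj
    have := Finset.mem_range.1 hj
    omega
  rw [Finset.sum_congr rfl (g := fun j => if p ∣ j then
    γ ^ (n - j) * algebraMap ℚ L (1 / (n - j).factorial) *
      ((-γ) ^ (j / p) * algebraMap ℚ L (1 / (j / p).factorial)) else 0), ← Finset.sum_filter]
  · rw [dworkCoeff]
    refine Finset.sum_bij (fun j _ => p * j) ?_ ?_ ?_ ?_
    · intro j hj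
      rw [Finset.mem_range, Nat.lt_succ_iff, Nat.le_div_iff_mul_le hp0] at hj
      simp only [Finset.mem_filter, Finset.mem_range, dvd_mul_right, and_true]
      rw [mul_comm]; omega
    · intro a _ b _ hab
      exact Nat.eq_of_mul_eq_mul_left hp0 hab
    · intro b hb
      simp only [Finset.mem_filter, Finset.mem_range] at hb
      obtain ⟨hb, j, rfl⟩ := hb
      refine ⟨j, ?_, rfl⟩
      rw [Finset.mem_range, Nat.lt_succ_iff, Nat.le_div_iff_mul_le hp0, mul_comm]
      omega
    · intro j _
      simp [Nat.mul_div_cancel_left _ hp0, div_eq_mul_inv]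
  · intro j hj
    have := h j hj
    rw [this, mul_ite, mul_zero]
    congr 4

open PowerSeries in
theorem succ_mul_dworkCoeff_succ {L : Type*} [Field L] [CharZero L] {p : ℕ} (hp : p ≠ 0)
    {γ : L} (hγ : γ ^ (p - 1) = -(p : L)) (n : ℕ) :
    ((n : L) + 1) * dworkCoeff L p γ (n + 1) = γ * dworkCoeff L p γ n +
      if p - 1 ≤ n then γ ^ p * dworkCoeff L p γ (n - (p - 1)) else 0 := by
  have hexp : ∀ a : L, d⁄dX L (rescale a (exp L)) = C a * rescale a (exp L) := by
    intro a
    ext n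
    rw [coeff_derivative, coeff_C_mul, coeff_rescale, coeff_rescale, coeff_exp, coeff_exp]
    simp only [map_div₀, map_one, map_natCast, Nat.factorial_succ, Nat.cast_mul]
    have h1 : ((n.factorial : ℕ) : L) ≠ 0 := by exact_mod_cast n.factorial_ne_zero
    have h2 : (n : L) + 1 ≠ 0 := by exact_mod_cast n.succ_ne_zero
    push_cast
    field_simp
    ring
  have hD : d⁄dX L (PowerSeries.mk (dworkCoeff L p γ)) =
      C γ * PowerSeries.mk (dworkCoeff L p γ) +
        C (γ ^ p) * (X ^ (p - 1) * PowerSeries.mk (dworkCoeff L p γ)) := by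
    have hg : γ ^ p = - (γ * (p : L)) := by
      rw [← Nat.sub_one_add_one hp, pow_succ, hγ]
      rw [Nat.sub_one_add_one hp]; ring
    rw [mk_dworkCoeff hp, Derivation.leibniz, hexp, expand_apply,
      derivative_subst (HasSubst.X_pow hp), hexp, ← expand_apply p hp, map_mul, expand_C,
      derivative_pow, derivative_X, hg, ← expand_apply p hp]
    simp only [smul_eq_mul, map_neg, map_mul, map_natCast]
    ring
  have := congrArg (coeff n) hD
  rw [coeff_derivative, map_add, coeff_C_mul, coeff_C_mul, coeff_X_pow_mul', coeff_mk, coeff_mk]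
    at this
  rw [mul_comm, this]
  simp

theorem factorial_mul_dworkCoeff {L : Type*} [Field L] [CharZero L] {p : ℕ} (hp : p ≠ 0)
    {γ : L} (hγ : γ ^ (p - 1) = -(p : L)) (n : ℕ) :
    (n.factorial : L) * dworkCoeff L p γ n = γ ^ n * dworkNumerator p n := by
  induction n using Nat.strong_induction_on with
  | _ n ih =>
    cases n with
    | zero => simp [dworkCoeff, dworkNumerator]
    | succ n =>
      have h1 := ih n (by omega)
      rw [Nat.factorial_succ, dworkNumerator_succ]
      push_cast
      rw [mul_comm (_ + _ : L) (n.factorial : L), mul_assoc, succ_mul_dworkCoeff_succ hp hγ]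
      split_ifs with h
      · have h2 := ih (n - (p - 1)) (by omega)
        rw [← Nat.factorial_mul_descFactorial h] at h1 ⊢
        push_cast at h1 ⊢
        have e : γ ^ (n + 1) = γ ^ p * γ ^ (n - (p - 1)) := by
          rw [← pow_add]; congr 1; omega
        rw [mul_add (γ ^ (n + 1)), e]
        nth_rewrite 1 [← e]
        linear_combination γ * h1 + γ ^ p * (n.descFactorial (p - 1)) * h2
      · rw [Nat.descFactorial_eq_zero_iff_lt.2 (by omega)]
        push_cast
        linear_combination γ * h1

theorem norm_pow_sub_one_of_pow_eq_neg_prime {p : ℕ} {L : Type*} [NormedField L] {γ : L}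
    (hγ : γ ^ (p - 1) = -(p : L)) :
    ‖γ‖ ^ (p - 1) = ‖(p : L)‖ := by
  rw [← norm_pow, hγ, norm_neg]

section PadicNorm

variable {p : ℕ} [hp : Fact p.Prime] {L : Type*} [NormedField L] [Algebra ℚ_[p] L]

theorem norm_natCast_eq_norm_padic (hnorm : ∀ q : ℚ_[p], ‖algebraMap ℚ_[p] L q‖ = ‖q‖) (n : ℕ) :
    ‖(n : L)‖ = ‖(n : ℚ_[p])‖ := by
  rw [← hnorm, map_natCast]

theorem isUltrametricDist_of_norm_algebraMap_padic_s12
    (hnorm : ∀ q : ℚ_[p], ‖algebraMap ℚ_[p] L q‖ = ‖q‖) : IsUltrametricDist L :=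
  IsUltrametricDist.isUltrametricDist_of_forall_norm_natCast_le_one fun n => by
    rw [norm_natCast_eq_norm_padic hnorm]
    exact IsUltrametricDist.norm_natCast_le_one ℚ_[p] n

theorem norm_natCast_le_norm_prime_pow (hnorm : ∀ q : ℚ_[p], ‖algebraMap ℚ_[p] L q‖ = ‖q‖)
    {n k : ℕ} (h : p ^ k ∣ n) : ‖(n : L)‖ ≤ ‖(p : L)‖ ^ k := by
  obtain ⟨m, rfl⟩ := h
  push_cast
  rw [norm_mul, norm_pow, norm_natCast_eq_norm_padic hnorm m]
  exact mul_le_of_le_one_right (by positivity) (IsUltrametricDist.norm_natCast_le_one ℚ_[p] m)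

theorem norm_prime_lt_one (hnorm : ∀ q : ℚ_[p], ‖algebraMap ℚ_[p] L q‖ = ‖q‖) :
    ‖(p : L)‖ < 1 := by
  rw [norm_natCast_eq_norm_padic hnorm]
  exact Padic.norm_p_lt_one

theorem norm_prime_pos (hnorm : ∀ q : ℚ_[p], ‖algebraMap ℚ_[p] L q‖ = ‖q‖) :
    0 < ‖(p : L)‖ := by
  rw [norm_natCast_eq_norm_padic hnorm, norm_pos_iff]
  exact_mod_cast hp.out.ne_zero

variable {γ : L}

theorem norm_lt_one_of_pow_eq_neg_prime (hnorm : ∀ q : ℚ_[p], ‖algebraMap ℚ_[p] L q‖ = ‖q‖)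
    (hγ : γ ^ (p - 1) = -(p : L)) : ‖γ‖ < 1 := by
  by_contra! h
  have := one_le_pow₀ h (n := p - 1)
  rw [norm_pow_sub_one_of_pow_eq_neg_prime hγ] at this
  exact this.not_gt (norm_prime_lt_one hnorm)

theorem norm_pos_of_pow_eq_neg_prime (hnorm : ∀ q : ℚ_[p], ‖algebraMap ℚ_[p] L q‖ = ‖q‖)
    (hγ : γ ^ (p - 1) = -(p : L)) : 0 < ‖γ‖ := by
  rw [norm_pos_iff]
  rintro rfl
  have h1 := norm_pow_sub_one_of_pow_eq_neg_prime hγ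
  rw [norm_zero, zero_pow (by have := hp.out.two_le; omega)] at h1
  exact (norm_prime_pos hnorm).ne h1

theorem norm_prime_le_of_pow_eq_neg_prime (hnorm : ∀ q : ℚ_[p], ‖algebraMap ℚ_[p] L q‖ = ‖q‖)
    (hγ : γ ^ (p - 1) = -(p : L)) : ‖(p : L)‖ ≤ ‖γ‖ := by
  rw [← norm_pow_sub_one_of_pow_eq_neg_prime hγ]
  exact pow_le_of_le_one (norm_nonneg _) (norm_lt_one_of_pow_eq_neg_prime hnorm hγ).le
    (by have := hp.out.two_le; omega)

theorem norm_factorial_eq (hnorm : ∀ q : ℚ_[p], ‖algebraMap ℚ_[p] L q‖ = ‖q‖)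
    (hγ : γ ^ (p - 1) = -(p : L)) (n : ℕ) :
    ‖(n.factorial : L)‖ = ‖γ‖ ^ (n - (p.digits n).sum) := by
  rw [← sub_one_mul_padicValNat_factorial, pow_mul, norm_pow_sub_one_of_pow_eq_neg_prime hγ,
    norm_natCast_eq_norm_padic hnorm, norm_natCast_eq_norm_padic hnorm, Padic.norm_p,
    Padic.norm_eq_zpow_neg_valuation (by exact_mod_cast n.factorial_ne_zero),
    Padic.valuation_natCast]
  simp

theorem norm_pow_div_factorial_le (hnorm : ∀ q : ℚ_[p], ‖algebraMap ℚ_[p] L q‖ = ‖q‖)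
    (hγ : γ ^ (p - 1) = -(p : L)) {n : ℕ} (hn : n ≠ 0) :
    ‖γ ^ n / (n.factorial : L)‖ ≤ ‖γ‖ := by
  have h0 := norm_pos_of_pow_eq_neg_prime hnorm hγ
  have hlt := sub_one_mul_padicValNat_factorial_lt_of_ne_zero p hn
  rw [sub_one_mul_padicValNat_factorial] at hlt
  rw [norm_div, norm_factorial_eq hnorm hγ, norm_pow, div_le_iff₀ (by positivity), ← pow_succ']
  exact pow_le_pow_of_le_one h0.le (norm_lt_one_of_pow_eq_neg_prime hnorm hγ).le hlt

theorem norm_pow_div_factorial_le_one (hnorm : ∀ q : ℚ_[p], ‖algebraMap ℚ_[p] L q‖ = ‖q‖)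
    (hγ : γ ^ (p - 1) = -(p : L)) (n : ℕ) : ‖γ ^ n / (n.factorial : L)‖ ≤ 1 := by
  rcases eq_or_ne n 0 with rfl | hn
  · simp
  · exact (norm_pow_div_factorial_le hnorm hγ hn).trans
      (norm_lt_one_of_pow_eq_neg_prime hnorm hγ).le

theorem dworkCoeff_eq (hγ : γ ^ (p - 1) = -(p : L)) (n : ℕ) :
    dworkCoeff L p γ n = γ ^ n / (n.factorial : L) * dworkNumerator p n := by
  have : CharZero L := charZero_of_injective_algebraMap (algebraMap ℚ_[p] L).injective
  have h0 : (n.factorial : L) ≠ 0 := by exact_mod_cast n.factorial_ne_zero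
  have := factorial_mul_dworkCoeff hp.out.ne_zero hγ n
  field_simp
  linear_combination this

theorem norm_dworkCoeff_le_norm_prime_pow (hnorm : ∀ q : ℚ_[p], ‖algebraMap ℚ_[p] L q‖ = ‖q‖)
    (hγ : γ ^ (p - 1) = -(p : L)) (n : ℕ) :
    ‖dworkCoeff L p γ n‖ ≤ ‖(p : L)‖ ^ (n / (2 * p)) := by
  rw [dworkCoeff_eq hγ, norm_mul]
  refine (mul_le_of_le_one_left (norm_nonneg _) (norm_pow_div_factorial_le_one hnorm hγ n)).trans
    (norm_natCast_le_norm_prime_pow hnorm ?_)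
  rcases h : n / (2 * p) with _ | k
  · simp
  · refine pow_succ_dvd_dworkNumerator k n ?_
    have h1 := Nat.div_mul_le_self n (2 * p)
    rw [h] at h1
    nlinarith

theorem norm_dworkCoeff_le_norm_sq (hnorm : ∀ q : ℚ_[p], ‖algebraMap ℚ_[p] L q‖ = ‖q‖)
    (hγ : γ ^ (p - 1) = -(p : L)) {n : ℕ} (hn : 2 ≤ n) :
    ‖dworkCoeff L p γ n‖ ≤ ‖γ‖ ^ 2 := by
  have hγ1 := norm_lt_one_of_pow_eq_neg_prime hnorm hγ
  rw [dworkCoeff_eq hγ, norm_mul]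
  rcases lt_or_ge n p with h | h
  · have h1 : ‖(n.factorial : L)‖ = 1 := by
      rw [norm_natCast_eq_norm_padic hnorm, Padic.norm_natCast_eq_one_iff,
        hp.out.coprime_iff_not_dvd, hp.out.dvd_factorial]
      exact h.not_ge
    have h2 : ‖(dworkNumerator p n : L)‖ ≤ 1 := by
      simpa using norm_natCast_le_norm_prime_pow hnorm (k := 0)
        (n := dworkNumerator p n) (by simp)
    rw [norm_div, h1, div_one, norm_pow]
    exact (mul_le_of_le_one_right (by positivity) h2).trans
      (pow_le_pow_of_le_one (norm_nonneg _) hγ1.le hn)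
  · rw [sq]
    refine mul_le_mul (norm_pow_div_factorial_le hnorm hγ (by omega)) ?_ (norm_nonneg _)
      (norm_nonneg _)
    refine le_trans ?_ (norm_prime_le_of_pow_eq_neg_prime hnorm hγ)
    simpa using norm_natCast_le_norm_prime_pow hnorm
      (pow_succ_dvd_dworkNumerator 0 n (by simpa using h))

theorem summable_pow_div {r : ℝ} (hr0 : 0 < r) (hr1 : r < 1) {K : ℕ} (hK : K ≠ 0) :
    Summable fun n : ℕ => r ^ (n / K) := by
  set ρ : ℝ := r ^ ((K : ℝ)⁻¹) with hρ
  have hρ0 : 0 < ρ := Real.rpow_pos_of_pos hr0 _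
  have hρ1 : ρ < 1 := Real.rpow_lt_one hr0.le hr1 (by positivity)
  have hρK : ρ ^ K = r := Real.rpow_inv_natCast_pow hr0.le hK
  refine Summable.of_nonneg_of_le (fun n => by positivity) (fun n => ?_)
    ((summable_geometric_of_lt_one hρ0.le hρ1).mul_left r⁻¹)
  rw [le_inv_mul_iff₀ hr0, ← pow_succ', ← hρK, ← pow_mul]
  exact pow_le_pow_of_le_one hρ0.le hρ1.le
    (Nat.lt_mul_div_succ n (Nat.pos_of_ne_zero hK)).le

theorem summable_norm_dworkCoeff_mul (hnorm : ∀ q : ℚ_[p], ‖algebraMap ℚ_[p] L q‖ = ‖q‖)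
    (hγ : γ ^ (p - 1) = -(p : L)) {x : L} (hx : ‖x‖ ≤ 1) :
    Summable fun n => ‖dworkCoeff L p γ n * x ^ n‖ := by
  refine Summable.of_nonneg_of_le (fun n => norm_nonneg _) (fun n => ?_)
    (summable_pow_div (norm_prime_pos hnorm) (norm_prime_lt_one hnorm)
      (mul_ne_zero two_ne_zero hp.out.ne_zero))
  rw [norm_mul, norm_pow]
  exact (mul_le_of_le_one_right (norm_nonneg _) (pow_le_one₀ (norm_nonneg _) hx)).trans
    (norm_dworkCoeff_le_norm_prime_pow hnorm hγ n)

theorem norm_tsum_dworkCoeff_sub_le [CompleteSpace L]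
    (hnorm : ∀ q : ℚ_[p], ‖algebraMap ℚ_[p] L q‖ = ‖q‖)
    (hγ : γ ^ (p - 1) = -(p : L)) {x : L} (hx : ‖x‖ ≤ 1) :
    ‖∑' k, dworkCoeff L p γ k * x ^ k - (1 + γ * x)‖ ≤ ‖γ‖ ^ 2 := by
  have := isUltrametricDist_of_norm_algebraMap_padic_s12 hnorm
  have h0 : dworkCoeff L p γ 0 = 1 := by simp [dworkCoeff_eq hγ, dworkNumerator]
  have h1 : dworkCoeff L p γ 1 = γ := by
    have hd : Nat.descFactorial 0 (p - 1) = 0 := by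
      rw [Nat.descFactorial_eq_zero_iff_lt]
      have := hp.out.two_le
      omega
    simp [dworkCoeff_eq hγ, dworkNumerator, hd]
  rw [← (summable_norm_dworkCoeff_mul hnorm hγ hx).of_norm.sum_add_tsum_nat_add 2,
    Finset.sum_range_succ, Finset.sum_range_one, h0, h1, pow_zero, pow_one, one_mul,
    add_sub_cancel_left]
  refine IsUltrametricDist.norm_tsum_le_of_forall_le_of_nonneg (by positivity) fun n => ?_
  rw [norm_mul, norm_pow]
  exact (mul_le_of_le_one_right (norm_nonneg _) (pow_le_one₀ (norm_nonneg _) hx)).trans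
    (norm_dworkCoeff_le_norm_sq hnorm hγ (by omega))

end PadicNorm

namespace PowerSeries

variable {R : Type*} [NormedCommRing R] {f g : PowerSeries R} {x : R}

theorem coeff_mul_mul_pow (f g : PowerSeries R) (x : R) (n : ℕ) :
    coeff n (f * g) * x ^ n = ∑ kl ∈ Finset.HasAntidiagonal.antidiagonal n,
      coeff kl.1 f * x ^ kl.1 * (coeff kl.2 g * x ^ kl.2) := by
  rw [coeff_mul, Finset.sum_mul]
  refine Finset.sum_congr rfl fun kl hkl => ?_
  rw [← Finset.HasAntidiagonal.mem_antidiagonal.1 hkl, pow_add]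
  ring

theorem summable_norm_coeff_mul_mul_pow (hf : Summable fun n => ‖coeff n f * x ^ n‖)
    (hg : Summable fun n => ‖coeff n g * x ^ n‖) :
    Summable fun n => ‖coeff n (f * g) * x ^ n‖ := by
  simp_rw [coeff_mul_mul_pow]
  exact summable_norm_sum_mul_antidiagonal_of_summable_norm
    (f := fun n => coeff n f * x ^ n) (g := fun n => coeff n g * x ^ n) hf hg

theorem tsum_coeff_mul_mul_pow [CompleteSpace R] (hf : Summable fun n => ‖coeff n f * x ^ n‖)
    (hg : Summable fun n => ‖coeff n g * x ^ n‖) :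
    ∑' n, coeff n (f * g) * x ^ n = (∑' n, coeff n f * x ^ n) * ∑' n, coeff n g * x ^ n := by
  simp_rw [coeff_mul_mul_pow]
  exact (tsum_mul_tsum_eq_tsum_sum_antidiagonal_of_summable_norm
    (f := fun n => coeff n f * x ^ n) (g := fun n => coeff n g * x ^ n) hf hg).symm

theorem tsum_coeff_one_mul_pow (x : R) : ∑' n, coeff n (1 : PowerSeries R) * x ^ n = 1 := by
  rw [tsum_eq_single 0 fun n hn => by simp [coeff_one, hn]]
  simp

theorem summable_norm_coeff_pow_mul_pow (hf : Summable fun n => ‖coeff n f * x ^ n‖) (k : ℕ) :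
    Summable fun n => ‖coeff n (f ^ k) * x ^ n‖ := by
  induction k with
  | zero =>
    refine summable_of_ne_finset_zero (s := {0}) fun n hn => ?_
    simp [coeff_one, Finset.mem_singleton.not.1 hn]
  | succ k ih => exact pow_succ f k ▸ summable_norm_coeff_mul_mul_pow ih hf

theorem tsum_coeff_pow_mul_pow [CompleteSpace R] (hf : Summable fun n => ‖coeff n f * x ^ n‖)
    (k : ℕ) : ∑' n, coeff n (f ^ k) * x ^ n = (∑' n, coeff n f * x ^ n) ^ k := by
  induction k with
  | zero => simp_rw [pow_zero, tsum_coeff_one_mul_pow]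
  | succ k ih =>
    rw [pow_succ, pow_succ, tsum_coeff_mul_mul_pow (summable_norm_coeff_pow_mul_pow hf k) hf, ih]

theorem coeff_expand_mul_pow_of_notMem_range {p : ℕ} (hp : p ≠ 0) (f : PowerSeries R) (x : R) :
    ∀ n ∉ Set.range (p * ·), coeff n (expand p hp f) * x ^ n = 0 := by
  intro n hn
  rw [coeff_expand_of_not_dvd, zero_mul]
  rintro ⟨k, rfl⟩
  exact hn ⟨k, rfl⟩

theorem summable_norm_coeff_expand_mul_pow {p : ℕ} (hp : p ≠ 0)
    (hf : Summable fun n => ‖coeff n f * (x ^ p) ^ n‖) :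
    Summable fun n => ‖coeff n (expand p hp f) * x ^ n‖ := by
  rw [← (mul_right_injective₀ hp).summable_iff]
  · simpa [Function.comp_def, pow_mul] using hf
  · intro n hn
    rw [coeff_expand_mul_pow_of_notMem_range hp f x n hn, norm_zero]

theorem tsum_coeff_expand_mul_pow {p : ℕ} (hp : p ≠ 0) (f : PowerSeries R) (x : R) :
    ∑' n, coeff n (expand p hp f) * x ^ n = ∑' n, coeff n f * (x ^ p) ^ n := by
  rw [← (mul_right_injective₀ hp).tsum_eq]
  · simp [pow_mul]
  · intro n hn
    by_contra h
    exact hn (coeff_expand_mul_pow_of_notMem_range hp f x n h)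

end PowerSeries

open PowerSeries in
theorem mk_dworkCoeff_pow_mul_expand {L : Type*} [Field L] [CharZero L] {p : ℕ} (hp : p ≠ 0)
    (γ : L) :
    PowerSeries.mk (dworkCoeff L p γ) ^ p * expand p hp (rescale (p * γ) (exp L)) =
      rescale (p * γ) (exp L) := by
  have h : ∀ a : L, rescale a (exp L) ^ p = rescale (p * a) (exp L) := fun a => by
    rw [← map_pow, exp_pow_eq_rescale_exp, rescale_rescale, mul_comm]
  rw [mk_dworkCoeff hp, mul_pow, h, ← map_pow, h, mul_assoc, ← map_mul, exp_mul_exp_eq_exp_add]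
  simp

section Orbit

variable {p : ℕ} [hp : Fact p.Prime] {L : Type*} [NormedField L] [Algebra ℚ_[p] L] {γ : L}

open PowerSeries in
theorem summable_norm_coeff_rescale_exp [CharZero L]
    (hnorm : ∀ q : ℚ_[p], ‖algebraMap ℚ_[p] L q‖ = ‖q‖)
    (hγ : γ ^ (p - 1) = -(p : L)) {a x : L} (ha : ‖a‖ = ‖(p : L)‖ * ‖γ‖) (hx : ‖x‖ ≤ 1) :
    Summable fun n => ‖coeff n (rescale a (exp L)) * x ^ n‖ := by
  refine Summable.of_nonneg_of_le (fun n => norm_nonneg _) (fun n => ?_)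
    (summable_geometric_of_lt_one (norm_nonneg (p : L)) (norm_prime_lt_one hnorm))
  have h := norm_pow_div_factorial_le_one hnorm hγ n
  rw [norm_div, norm_pow] at h
  rw [coeff_rescale, coeff_exp, norm_mul, norm_mul, norm_pow, norm_pow, ha, mul_pow]
  simp only [map_div₀, map_one, map_natCast, norm_div, norm_one]
  calc ‖(p : L)‖ ^ n * ‖γ‖ ^ n * (1 / ‖(n.factorial : L)‖) * ‖x‖ ^ n
      = ‖(p : L)‖ ^ n * ((‖γ‖ ^ n / ‖(n.factorial : L)‖) * ‖x‖ ^ n) := by ring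
    _ ≤ ‖(p : L)‖ ^ n := mul_le_of_le_one_right (by positivity)
      (mul_le_one₀ h (by positivity) (pow_le_one₀ (norm_nonneg _) hx))

open PowerSeries in
/-- The `p`-th power of the Dwork series at `x` is the quotient of the values at `x` and `x ^ p`
of a function without zeros on the unit ball, namely `x ↦ exp (p * γ * x)`. -/
theorem exists_tsum_dworkCoeff_pow_mul_eq [CompleteSpace L]
    (hnorm : ∀ q : ℚ_[p], ‖algebraMap ℚ_[p] L q‖ = ‖q‖) (hγ : γ ^ (p - 1) = -(p : L)) :
    ∃ G : L → L, ∀ x, ‖x‖ ≤ 1 → G x ≠ 0 ∧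
      (∑' k, dworkCoeff L p γ k * x ^ k) ^ p * G (x ^ p) = G x := by
  have : CharZero L := charZero_of_injective_algebraMap (algebraMap ℚ_[p] L).injective
  refine ⟨fun x => ∑' n, coeff n (rescale (p * γ) (exp L)) * x ^ n, fun x hx => ?_⟩
  have hxp : ‖x ^ p‖ ≤ 1 := by
    rw [norm_pow]
    exact pow_le_one₀ (norm_nonneg _) hx
  have hs : ∀ {y : L}, ‖y‖ ≤ 1 → Summable fun n => ‖coeff n (rescale (p * γ) (exp L)) * y ^ n‖ :=
    summable_norm_coeff_rescale_exp hnorm hγ (norm_mul _ _)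
  have hE : Summable fun n => ‖coeff n (PowerSeries.mk (dworkCoeff L p γ)) * x ^ n‖ := by
    simpa only [coeff_mk] using summable_norm_dworkCoeff_mul hnorm hγ hx
  constructor
  · refine left_ne_zero_of_mul_eq_one
      (b := ∑' n, coeff n (rescale (-(p * γ)) (exp L)) * x ^ n) ?_
    rw [← tsum_coeff_mul_mul_pow (hs hx)
      (summable_norm_coeff_rescale_exp hnorm hγ (by rw [norm_neg, norm_mul]) hx),
      exp_mul_exp_eq_exp_add, add_neg_cancel]
    simp
  · have h := tsum_coeff_mul_mul_pow (summable_norm_coeff_pow_mul_pow hE p)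
      (summable_norm_coeff_expand_mul_pow hp.out.ne_zero (hs hxp))
    rw [mk_dworkCoeff_pow_mul_expand, tsum_coeff_pow_mul_pow hE, tsum_coeff_expand_mul_pow] at h
    simpa only [coeff_mk] using h.symm

theorem prod_tsum_dworkCoeff_pow_eq_one [CompleteSpace L]
    (hnorm : ∀ q : ℚ_[p], ‖algebraMap ℚ_[p] L q‖ = ‖q‖) (hγ : γ ^ (p - 1) = -(p : L))
    {d : ℕ} {c : L} (hc : ‖c‖ ≤ 1) (hfrob : c ^ (p ^ d) = c) :
    (∏ n ∈ Finset.range d, ∑' k, dworkCoeff L p γ k * (c ^ (p ^ n)) ^ k) ^ p = 1 := by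
  obtain ⟨G, hG⟩ := exists_tsum_dworkCoeff_pow_mul_eq hnorm hγ
  have hcn : ∀ n, ‖c ^ (p ^ n)‖ ≤ 1 := fun n => by
    rw [norm_pow]
    exact pow_le_one₀ (norm_nonneg _) hc
  have h1 : (∏ n ∈ Finset.range d, ∑' k, dworkCoeff L p γ k * (c ^ (p ^ n)) ^ k) ^ p *
      ∏ n ∈ Finset.range d, G (c ^ p ^ (n + 1)) = ∏ n ∈ Finset.range d, G (c ^ p ^ n) := by
    rw [← Finset.prod_pow, ← Finset.prod_mul_distrib]
    refine Finset.prod_congr rfl fun n _ => ?_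
    rw [pow_succ p, pow_mul c, (hG _ (hcn n)).2]
  have h2 := Finset.prod_range_succ' (fun n => G (c ^ p ^ n)) d
  rw [Finset.prod_range_succ, hfrob, pow_zero, pow_one] at h2
  rw [← mul_right_cancel₀ (hG c hc).1 h2] at h1
  exact mul_right_cancel₀ (Finset.prod_ne_zero_iff.2 fun n _ => (hG _ (hcn n)).1)
    (h1.trans (one_mul _).symm)

theorem norm_prod_sub_one_add_mul_sum_le {L : Type*} [NormedField L] [IsUltrametricDist L]
    {γ : L} (hγ : ‖γ‖ ≤ 1) {F x : ℕ → L} (hx : ∀ n, ‖x n‖ ≤ 1)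
    (hF : ∀ n, ‖F n - (1 + γ * x n)‖ ≤ ‖γ‖ ^ 2) (d : ℕ) :
    ‖∏ n ∈ Finset.range d, F n - (1 + γ * ∑ n ∈ Finset.range d, x n)‖ ≤ ‖γ‖ ^ 2 := by
  induction d with
  | zero => simp
  | succ d ih =>
    have hs : ‖∑ n ∈ Finset.range d, x n‖ ≤ 1 :=
      IsUltrametricDist.norm_sum_le_of_forall_le_of_nonneg zero_le_one fun n _ => hx n
    have h1 : ‖1 + γ * ∑ n ∈ Finset.range d, x n‖ ≤ 1 := by
      refine (IsUltrametricDist.norm_add_le_max _ _).trans (max_le norm_one.le ?_)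
      rw [norm_mul]
      exact mul_le_one₀ hγ (norm_nonneg _) hs
    have h2 : ‖F d‖ ≤ 1 := by
      rw [← sub_add_cancel (F d) (1 + γ * x d)]
      refine (IsUltrametricDist.norm_add_le_max _ _).trans
        (max_le ((hF d).trans (pow_le_one₀ (norm_nonneg _) hγ)) ?_)
      refine (IsUltrametricDist.norm_add_le_max _ _).trans (max_le norm_one.le ?_)
      rw [norm_mul]
      exact mul_le_one₀ hγ (norm_nonneg _) (hx d)
    rw [Finset.prod_range_succ, Finset.sum_range_succ]
    set P := ∏ n ∈ Finset.range d, F n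
    set S := ∑ n ∈ Finset.range d, x n
    have e : P * F d - (1 + γ * (S + x d)) = (P - (1 + γ * S)) * F d +
        ((1 + γ * S) * (F d - (1 + γ * x d)) + γ ^ 2 * (S * x d)) := by ring
    rw [e]
    refine (IsUltrametricDist.norm_add_le_max _ _).trans (max_le ?_
      ((IsUltrametricDist.norm_add_le_max _ _).trans (max_le ?_ ?_)))
    · rw [norm_mul]
      exact (mul_le_of_le_one_right (norm_nonneg _) h2).trans ih
    · rw [norm_mul]
      exact (mul_le_of_le_one_left (norm_nonneg _) h1).trans (hF d)
    · rw [norm_mul, norm_mul, norm_pow]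
      exact mul_le_of_le_one_right (by positivity) (mul_le_one₀ hs (norm_nonneg _) (hx d))

theorem eq_one_of_pow_prime_eq_one_of_norm_sub_one_lt
    (hnorm : ∀ q : ℚ_[p], ‖algebraMap ℚ_[p] L q‖ = ‖q‖) (hγ : γ ^ (p - 1) = -(p : L))
    {z : L} (hz : z ^ p = 1) (hlt : ‖z - 1‖ < ‖γ‖) : z = 1 := by
  have := isUltrametricDist_of_norm_algebraMap_padic_s12 hnorm
  have hp2 := hp.out.two_le
  by_contra hne
  obtain ⟨w, rfl⟩ : ∃ w, z = w + 1 := ⟨z - 1, by ring⟩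
  rw [add_sub_cancel_right] at hlt
  have hw : 0 < ‖w‖ := norm_pos_iff.2 fun h => hne (by simp [h])
  have hw1 : ‖w‖ < 1 := hlt.trans (norm_lt_one_of_pow_eq_neg_prime hnorm hγ)
  have hp0 := norm_prime_pos hnorm
  have hpow : ‖w‖ ^ (p - 1) < ‖(p : L)‖ := by
    rw [← norm_pow_sub_one_of_pow_eq_neg_prime hγ]
    exact pow_lt_pow_left₀ hlt hw.le (by omega)
  have hsum : (p : L) * w = -∑ m ∈ Finset.range (p - 1), w ^ (m + 2) * (p.choose (m + 2) : L) := by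
    rw [add_pow, show p + 1 = p - 1 + 1 + 1 by omega, Finset.sum_range_succ',
      Finset.sum_range_succ'] at hz
    simp only [one_pow, mul_one, zero_add, pow_zero, pow_one, Nat.choose_zero_right,
      Nat.choose_one_right, Nat.cast_one, add_assoc, Nat.reduceAdd] at hz
    linear_combination hz
  have hbound : ‖(p : L) * w‖ ≤ ‖w‖ * max (‖(p : L)‖ * ‖w‖) (‖w‖ ^ (p - 1)) := by
    rw [hsum, norm_neg]
    refine IsUltrametricDist.norm_sum_le_of_forall_le_of_nonneg (by positivity) fun m hm => ?_
    rw [norm_mul, norm_pow, pow_succ', mul_assoc]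
    refine mul_le_mul_of_nonneg_left ?_ hw.le
    rcases (show m + 2 ≤ p by have := Finset.mem_range.1 hm; omega).eq_or_lt with h | h
    · rw [h, Nat.choose_self, show m + 1 = p - 1 by omega]
      simp
    · refine le_max_of_le_left ?_
      rw [mul_comm]
      have h1 := norm_natCast_le_norm_prime_pow hnorm (k := 1)
        (by simpa using hp.out.dvd_choose_self (by omega) h)
      rw [pow_one] at h1
      exact mul_le_mul h1 (pow_le_of_le_one hw.le hw1.le (by omega)) (by positivity) hp0.le
  have hstrict : max (‖(p : L)‖ * ‖w‖) (‖w‖ ^ (p - 1)) < ‖(p : L)‖ :=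
    max_lt (mul_lt_of_lt_one_right hp0 hw1) hpow
  refine (mul_lt_mul_of_pos_left hstrict hw).not_ge (le_trans (le_of_eq ?_) hbound)
  rw [norm_mul, mul_comm]

end Orbit

/-- **Norm of Dwork values along a Frobenius orbit.**  If `c ∈ L` satisfies `‖c‖ ≤ 1`
and `c^(p^d) = c`, and `m : ℕ` is such that the "trace" `Σ_{n < d} c^{p^n}` is congruent
to `m` modulo the maximal ideal (i.e. `‖Σ_{n < d} c^{p^n} − m‖ < 1`), then
`∏_{n < d} E_γ(c^{p^n}) = E_γ(1)^m`. -/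
theorem dworkSeries_prod_frobenius_orbit
    (p : ℕ) [Fact p.Prime] (L : Type*) [NormedField L] [CompleteSpace L]
    [Algebra ℚ_[p] L] (hnorm : ∀ q : ℚ_[p], ‖algebraMap ℚ_[p] L q‖ = ‖q‖)
    (γ : L) (hγ : γ ^ (p - 1) = -(p : L))
    (d : ℕ) (hd : 1 ≤ d) (c : L) (hc : ‖c‖ ≤ 1) (hfrob : c ^ (p ^ d) = c)
    (m : ℕ) (hm : ‖(∑ n ∈ Finset.range d, c ^ (p ^ n)) - (m : L)‖ < 1) :
    (∏ n ∈ Finset.range d, ∑' k : ℕ, dworkCoeff L p γ k * (c ^ (p ^ n)) ^ k)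
      = (∑' k : ℕ, dworkCoeff L p γ k) ^ m := by
  have := isUltrametricDist_of_norm_algebraMap_padic_s12 hnorm
  have hp0 : p ≠ 0 := (Fact.out : p.Prime).ne_zero
  have hγ0 := norm_pos_of_pow_eq_neg_prime hnorm hγ
  have hγ1 := norm_lt_one_of_pow_eq_neg_prime hnorm hγ
  have hP := prod_tsum_dworkCoeff_pow_eq_one hnorm hγ hc hfrob
  have hζ : (∑' k, dworkCoeff L p γ k) ^ p = 1 := by
    simpa using prod_tsum_dworkCoeff_pow_eq_one hnorm hγ (d := 1) (c := 1) norm_one.le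
      (one_pow _)
  have hPa := norm_prod_sub_one_add_mul_sum_le hγ1.le
    (F := fun n => ∑' k, dworkCoeff L p γ k * (c ^ (p ^ n)) ^ k) (x := fun n => c ^ (p ^ n))
    (fun n => by rw [norm_pow]; exact pow_le_one₀ (norm_nonneg _) hc)
    (fun n => norm_tsum_dworkCoeff_sub_le hnorm hγ
      (by rw [norm_pow]; exact pow_le_one₀ (norm_nonneg _) hc)) d
  have hζa := norm_prod_sub_one_add_mul_sum_le hγ1.le
    (F := fun _ => ∑' k, dworkCoeff L p γ k) (x := fun _ => 1) (fun _ => norm_one.le)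
    (fun _ => by simpa using norm_tsum_dworkCoeff_sub_le hnorm hγ (x := 1) norm_one.le) m
  simp only [Finset.prod_const, Finset.card_range, Finset.sum_const, nsmul_eq_mul, mul_one] at hζa
  set P := ∏ n ∈ Finset.range d, ∑' k : ℕ, dworkCoeff L p γ k * (c ^ (p ^ n)) ^ k
  set ζ := ∑' k : ℕ, dworkCoeff L p γ k
  have hζm : (ζ ^ m) ^ p = 1 := by rw [pow_right_comm, hζ, one_pow]
  have hζ0 : ζ ^ m ≠ 0 := fun h => by simp [h, hp0] at hζm
  have hζn : ‖ζ ^ m‖ = 1 := by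
    rw [← pow_eq_one_iff_of_nonneg (norm_nonneg _) hp0, ← norm_pow, hζm, norm_one]
  have hsq : ‖γ‖ ^ 2 < ‖γ‖ := pow_lt_self_of_lt_one₀ hγ0 hγ1 one_lt_two
  have hlt : ‖P - ζ ^ m‖ < ‖γ‖ := by
    have e : P - ζ ^ m = (P - (1 + γ * ∑ n ∈ Finset.range d, c ^ (p ^ n))) +
        (γ * ((∑ n ∈ Finset.range d, c ^ (p ^ n)) - m) + ((1 + γ * m) - ζ ^ m)) := by ring
    rw [norm_sub_rev] at hζa
    rw [e]
    refine (IsUltrametricDist.norm_add_le_max _ _).trans_lt (max_lt (hPa.trans_lt hsq)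
      ((IsUltrametricDist.norm_add_le_max _ _).trans_lt (max_lt ?_ (hζa.trans_lt hsq))))
    rw [norm_mul]
    exact mul_lt_of_lt_one_right hγ0 hm
  refine eq_of_div_eq_one (eq_one_of_pow_prime_eq_one_of_norm_sub_one_lt hnorm hγ ?_ ?_)
  · rw [div_pow, hP, hζm, div_one]
  · rwa [div_sub_one hζ0, norm_div, hζn, div_one]
end
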